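/- arXiv:1710.00608 — 2 statements merged into one kernel-verified Lean document; each statement's English description precedes it below -/
import Mathlib

section
/- Let n ≥ 2 be even and α ∈ (0,1). The explicit fair mechanism EM is column monotone: for all 1 ≤ i ≤ j, EM (i−1) j ≤ EM i j, and for all j ≤ i < n, EM (i+1) j ≤ EM i j. -/
open Finset

/-- A mechanism of size `n`: entries indexed by `{0,…,n}×{0,…,n}` are nonnegative
and each column sums to 1. `P i j` is the probability of output `i` on input `j`. -/
def IsMechanism (n : ℕ) (P : ℕ → ℕ → ℝ) : Prop :=
  (∀ i j, i ≤ n → j ≤ n → 0 ≤ P i j) ∧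
  (∀ j, j ≤ n → ∑ i ∈ Finset.range (n + 1), P i j = 1)

/-- `α`-differential privacy: for all rows `i` and adjacent columns `j`, `j+1`,
`α·P i (j+1) ≤ P i j` and `α·P i j ≤ P i (j+1)`. -/
def IsDP (n : ℕ) (α : ℝ) (P : ℕ → ℕ → ℝ) : Prop :=
  ∀ i j, i ≤ n → j < n → α * P i (j + 1) ≤ P i j ∧ α * P i j ≤ P i (j + 1)

/-- Trace of a mechanism of size `n`. -/
noncomputable def mechTrace (n : ℕ) (P : ℕ → ℕ → ℝ) : ℝ :=
  ∑ i ∈ Finset.range (n + 1), P i i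

/-- The truncated geometric mechanism: `GM i j = x·α^|i−j|` if `i = 0` or `i = n`,
and `y·α^|i−j|` otherwise, where `x = 1/(1+α)`, `y = (1−α)/(1+α)`. -/
noncomputable def GM (n : ℕ) (α : ℝ) (i j : ℕ) : ℝ :=
  (if i = 0 ∨ i = n then 1 / (1 + α) else (1 - α) / (1 + α)) * α ^ Nat.dist i j

/-- The explicit fair mechanism: `EM i j = y·α^|i−j|` if `|i−j| < min(j, n−j)`,
and `y·α^⌈(|i−j|+min(j,n−j))/2⌉` otherwise, where `y = (1−α)/(1+α−2α^(n/2+1))`. -/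
noncomputable def EM (n : ℕ) (α : ℝ) (i j : ℕ) : ℝ :=
  (1 - α) / (1 + α - 2 * α ^ (n / 2 + 1)) *
    (if Nat.dist i j < min j (n - j) then α ^ Nat.dist i j
     else α ^ ((Nat.dist i j + min j (n - j) + 1) / 2))

/-- Row monotone: entries in each row are nonincreasing moving away from the diagonal. -/
def RowMonotone (n : ℕ) (P : ℕ → ℕ → ℝ) : Prop :=
  (∀ i j, 1 ≤ j → j ≤ i → i ≤ n → P i (j - 1) ≤ P i j) ∧
  (∀ i j, i ≤ j → j < n → P i (j + 1) ≤ P i j)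

/-- Column monotone: entries in each column are nonincreasing moving away from the diagonal. -/
def ColMonotone (n : ℕ) (P : ℕ → ℕ → ℝ) : Prop :=
  (∀ i j, 1 ≤ i → i ≤ j → j ≤ n → P (i - 1) j ≤ P i j) ∧
  (∀ i j, j ≤ i → i < n → P (i + 1) j ≤ P i j)

/-- Row honesty: `P i i ≥ P i j` for all `i, j`. -/
def RowHonest (n : ℕ) (P : ℕ → ℕ → ℝ) : Prop :=
  ∀ i j, i ≤ n → j ≤ n → P i j ≤ P i i

/-- Column honesty: `P j j ≥ P i j` for all `i, j`. -/
def ColHonest (n : ℕ) (P : ℕ → ℕ → ℝ) : Prop :=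
  ∀ i j, i ≤ n → j ≤ n → P i j ≤ P j j

/-- Weak honesty: `P i i ≥ 1/(n+1)` for all `i`. -/
def WeaklyHonest (n : ℕ) (P : ℕ → ℕ → ℝ) : Prop :=
  ∀ i, i ≤ n → 1 / ((n : ℝ) + 1) ≤ P i i

/-- Fairness: all diagonal entries are equal. -/
def Fair (n : ℕ) (P : ℕ → ℕ → ℝ) : Prop :=
  ∀ i j, i ≤ n → j ≤ n → P i i = P j j

/-- The normalising constant of `EM` is nonnegative. -/
lemma em_const_nonneg (n : ℕ) {α : ℝ} (hα0 : 0 ≤ α) (hα1 : α ≤ 1) :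
    0 ≤ (1 - α) / (1 + α - 2 * α ^ (n / 2 + 1)) := by
  have hpow : α ^ (n / 2 + 1) ≤ α := pow_le_of_le_one hα0 hα1 (Nat.succ_ne_zero _)
  exact div_nonneg (by linarith) (by linarith)

/-- Within a column, `EM` is antitone in the distance to the diagonal. -/
lemma em_le_of_dist_le (n : ℕ) {α : ℝ} (hα0 : 0 ≤ α) (hα1 : α ≤ 1) {i i' j : ℕ}
    (hdist : Nat.dist i j ≤ Nat.dist i' j) : EM n α i' j ≤ EM n α i j := by
  unfold EM
  refine mul_le_mul_of_nonneg_left ?_ (em_const_nonneg n hα0 hα1)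
  split_ifs <;> exact pow_le_pow_of_le_one hα0 hα1 (by omega)

/-- for even `n ≥ 2` and `α ∈ (0,1)`, `EM` is column monotone. -/
theorem em_col_monotone (n : ℕ) (α : ℝ) (hn : 2 ≤ n) (heven : Even n)
    (hα0 : 0 < α) (hα1 : α < 1) :
    ColMonotone n (EM n α) := by
  exact ⟨fun i j _ _ _ => em_le_of_dist_le n hα0.le hα1.le (by unfold Nat.dist; omega),
    fun i j _ _ => em_le_of_dist_le n hα0.le hα1.le (by unfold Nat.dist; omega)⟩
end

section
/- Let n ≥ 2 be even and α ∈ (0,1). The explicit fair mechanism EM is an optimal fair mechanism under the L0 objective: for every fair mechanism P of size n satisfying α-differential privacy, trace(P) ≤ trace(EM), equivalently ((n+1) − trace(P))/n ≥ ((n+1) − trace(EM))/n. -/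
open Finset

/-- Moving left by `d` columns costs at most a factor `α ^ d`. -/
lemma IsDP.pow_mul_le_left {n : ℕ} {α : ℝ} {P : ℕ → ℕ → ℝ} (hdp : IsDP n α P) (hα : 0 ≤ α)
    {i j : ℕ} (hi : i ≤ n) (d : ℕ) (hd : j + d ≤ n) : α ^ d * P i (j + d) ≤ P i j := by
  induction d with
  | zero => simp
  | succ d ih =>
    calc α ^ (d + 1) * P i (j + (d + 1)) = α ^ d * (α * P i (j + d + 1)) := by
          rw [pow_succ, mul_assoc, ← add_assoc]
      _ ≤ α ^ d * P i (j + d) :=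
          mul_le_mul_of_nonneg_left (hdp i (j + d) hi (by omega)).1 (pow_nonneg hα d)
      _ ≤ P i j := ih (by omega)

/-- Moving right by `d` columns costs at most a factor `α ^ d`. -/
lemma IsDP.pow_mul_le_right {n : ℕ} {α : ℝ} {P : ℕ → ℕ → ℝ} (hdp : IsDP n α P) (hα : 0 ≤ α)
    {i j : ℕ} (hi : i ≤ n) (d : ℕ) (hd : j + d ≤ n) : α ^ d * P i j ≤ P i (j + d) := by
  induction d with
  | zero => simp
  | succ d ih =>
    calc α ^ (d + 1) * P i j = α * (α ^ d * P i j) := by ring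
      _ ≤ α * P i (j + d) := mul_le_mul_of_nonneg_left (ih (by omega)) hα
      _ ≤ P i (j + (d + 1)) := (hdp i (j + d) hi (by omega)).2

lemma IsDP.pow_dist_mul_le {n : ℕ} {α : ℝ} {P : ℕ → ℕ → ℝ} (hdp : IsDP n α P) (hα : 0 ≤ α)
    {i j k : ℕ} (hi : i ≤ n) (hj : j ≤ n) (hk : k ≤ n) :
    α ^ Nat.dist j k * P i j ≤ P i k := by
  rcases le_total j k with h | h
  · obtain ⟨d, rfl⟩ := Nat.exists_eq_add_of_le h
    simpa [Nat.dist] using hdp.pow_mul_le_right hα hi d hk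
  · obtain ⟨d, rfl⟩ := Nat.exists_eq_add_of_le h
    simpa [Nat.dist] using hdp.pow_mul_le_left hα hi d hj

lemma one_sub_mul_sum_pow_sub (α : ℝ) (m : ℕ) :
    (1 - α) * ∑ i ∈ range m, α ^ (m - i) = α - α ^ (m + 1) := by
  induction m with
  | zero => simp
  | succ m ih =>
    rw [sum_range_succ', mul_add]
    simp only [Nat.add_sub_add_right, ih, Nat.sub_zero]
    ring

lemma one_sub_mul_sum_pow_dist (α : ℝ) (m : ℕ) :
    (1 - α) * ∑ i ∈ range (m + m + 1), α ^ Nat.dist i m = 1 + α - 2 * α ^ (m + 1) := by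
  have hleft : ∑ i ∈ range m, α ^ Nat.dist i m = ∑ i ∈ range m, α ^ (m - i) :=
    sum_congr rfl fun i hi => by rw [Nat.dist_eq_sub_of_le (mem_range.mp hi).le]
  have hright : ∑ i ∈ range (m + 1), α ^ Nat.dist (m + i) m = ∑ i ∈ range (m + 1), α ^ i :=
    sum_congr rfl fun i _ => by simp [Nat.dist]
  rw [add_assoc, sum_range_add, hleft, hright, mul_add, one_sub_mul_sum_pow_sub, mul_neg_geom_sum]
  ring

lemma EM_diag (n : ℕ) (α : ℝ) (i : ℕ) :
    EM n α i i = (1 - α) / (1 + α - 2 * α ^ (n / 2 + 1)) := by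
  rcases Nat.eq_zero_or_pos (min i (n - i)) with h | h <;> simp [EM, h]

/-- for even `n ≥ 2` and `α ∈ (0,1)`, `EM` is an optimal fair mechanism
under the `L0` objective: every fair `α`-DP mechanism `P` satisfies `trace(P) ≤ trace(EM)`. -/
theorem em_optimal_fair (n : ℕ) (α : ℝ) (hn : 2 ≤ n) (heven : Even n)
    (hα0 : 0 < α) (hα1 : α < 1) (P : ℕ → ℕ → ℝ)
    (hP : IsMechanism n P) (hdp : IsDP n α P) (hfair : Fair n P) :
    mechTrace n P ≤ mechTrace n (EM n α) := by
  obtain ⟨m, rfl⟩ := heven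
  have hsum := one_sub_mul_sum_pow_dist α m
  have hpos : 0 < ∑ i ∈ range (m + m + 1), α ^ Nat.dist i m :=
    sum_pos (fun i _ => pow_pos hα0 _) (by simp)
  have hmid : (∑ i ∈ range (m + m + 1), α ^ Nat.dist i m) * P m m ≤ 1 := by
    rw [← hP.2 m (by omega), sum_mul]
    refine sum_le_sum fun i hi => ?_
    have hi' : i ≤ m + m := Nat.lt_succ_iff.mp (mem_range.mp hi)
    rw [hfair m i (by omega) hi']
    exact hdp.pow_dist_mul_le hα0.le hi' hi' (by omega)
  refine sum_le_sum fun i hi => ?_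
  rw [EM_diag, hfair i m (Nat.lt_succ_iff.mp (mem_range.mp hi)) (by omega),
    show (m + m) / 2 = m by omega, ← hsum, le_div_iff₀ (mul_pos (sub_pos.mpr hα1) hpos)]
  nlinarith [mul_le_mul_of_nonneg_left hmid (sub_pos.mpr hα1).le]
end
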